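/- Let η be an m-dimensional Hamming embedding of a weighted graph G in which every coordinate changes across at least one edge. Then there is a bijection between the set of θ̂-equivalence classes of edges E(G)/θ̂ and the set of γ̂-equivalence classes of coordinates [m]/γ̂, sending the class of an edge uv to the class of any coordinate j ∈ D_η(u,v). -/

import Mathlib

open SimpleGraph

/-- The total weight of a walk in a weighted graph. -/
def walkWeight {V : Type*} {G : SimpleGraph V} (w : V → V → ℕ) {u v : V} (p : G.Walk u v) : ℕ :=
  (p.darts.map fun d => w d.toProd.1 d.toProd.2).sum

/-- The shortest-path (weighted) distance between two vertices. -/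
noncomputable def wdist {V : Type*} (G : SimpleGraph V) (w : V → V → ℕ) (u v : V) : ℕ :=
  sInf {n | ∃ p : G.Walk u v, walkWeight w p = n}
/-- The Djoković–Winkler relation on (oriented) edges, expressed via the shortest-path
metric `d`: edges `uv` and `ab` are related iff `[d(u,a) − d(u,b)] − [d(v,a) − d(v,b)] ≠ 0`. -/
def theta {V : Type*} (d : V → V → ℕ) (e f : V × V) : Prop :=
  ((d e.1 f.1 : ℤ) - d e.1 f.2) - ((d e.2 f.1 : ℤ) - d e.2 f.2) ≠ 0
/-- The relation γ on coordinates of a Hamming embedding: two coordinates are related iff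
their digits both change across some edge of the graph. -/
def gammaRel {V A : Type*} {m : ℕ} (G : SimpleGraph V) (η : V → Fin m → A)
    (j j' : Fin m) : Prop :=
  ∃ u v, G.Adj u v ∧ η u j ≠ η v j ∧ η u j' ≠ η v j'


section Helpers

variable {V A : Type*} [DecidableEq A] {m : ℕ}

lemma hd_sum (x y : Fin m → A) : (hammingDist x y : ℤ) = ∑ j, if x j ≠ y j then (1:ℤ) else 0 := by
  rw [Finset.sum_boole]; rfl

/-- Along a geodesic triple, a coordinate changes at most once. -/
lemma geo_once (x y z : Fin m → A) (h : hammingDist x z = hammingDist x y + hammingDist y z)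
    (j : Fin m) (h1 : x j ≠ y j) : y j = z j := by
  by_contra h2
  have h' : (hammingDist x z : ℤ) = hammingDist x y + hammingDist y z := by exact_mod_cast h
  rw [hd_sum, hd_sum, hd_sum, ← Finset.sum_add_distrib] at h'
  refine absurd h' (ne_of_lt (Finset.sum_lt_sum (fun i _ => ?_) ⟨j, Finset.mem_univ _, ?_⟩))
  · by_cases a : x i = y i <;> by_cases b : y i = z i <;> by_cases c : x i = z i <;>
      simp_all
  · rw [if_pos h1, if_pos h2]
    split_ifs <;> norm_num

lemma theta_common (η : V → Fin m → A) (d : V → V → ℕ)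
    (hemb : ∀ x y, d x y = hammingDist (η x) (η y)) (e f : V × V) (h : theta d e f) :
    ∃ j, η e.1 j ≠ η e.2 j ∧ η f.1 j ≠ η f.2 j := by
  by_contra hc
  push Not at hc
  apply h
  simp only [hemb, hd_sum, ← Finset.sum_sub_distrib]
  apply Finset.sum_eq_zero
  intro j _
  by_cases hj : η e.1 j = η e.2 j
  · rw [hj]; ring
  · rw [hc j hj]; ring

lemma wdist_adj_le (G : SimpleGraph V) (w : V → V → ℕ) {u v : V} (h : G.Adj u v) :
    wdist G w u v ≤ w u v :=
  Nat.sInf_le ⟨Walk.cons h Walk.nil, by simp [walkWeight]⟩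

lemma wdist_attained (G : SimpleGraph V) (w : V → V → ℕ) (hconn : G.Connected) (u v : V) :
    ∃ p : G.Walk u v, walkWeight w p = wdist G w u v :=
  Nat.sInf_mem (s := {n | ∃ p : G.Walk u v, walkWeight w p = n})
    ⟨_, (hconn.preconnected u v).some, rfl⟩

lemma walkWeight_cons {G : SimpleGraph V} (w : V → V → ℕ) {u v x : V} (h : G.Adj u v)
    (p : G.Walk v x) : walkWeight w (Walk.cons h p) = w u v + walkWeight w p := by
  simp [walkWeight]

lemma adj_coord (G : SimpleGraph V) (w : V → V → ℕ) (η : V → Fin m → A)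
    (hconn : G.Connected) (hpos : ∀ u v, G.Adj u v → 0 < w u v)
    (hemb : ∀ x y, wdist G w x y = hammingDist (η x) (η y)) {u v : V} (h : G.Adj u v) :
    ∃ j, η u j ≠ η v j := by
  by_contra hc
  push Not at hc
  have h0 : wdist G w u v = 0 := by rw [hemb, funext hc, hammingDist_self]
  obtain ⟨p, hp⟩ := wdist_attained G w hconn u v
  rw [h0] at hp
  cases p with
  | nil => exact G.loopless.irrefl _ h
  | cons h' q =>
    rw [walkWeight_cons] at hp
    have := hpos _ _ h'
    omega

/-- On a shortest walk between vertices differing at `j` some edge changes `j`. -/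
lemma geo_edge (G : SimpleGraph V) (w : V → V → ℕ) (η : V → Fin m → A)
    (hemb : ∀ x y, wdist G w x y = hammingDist (η x) (η y)) (j : Fin m) {a v : V}
    (p : G.Walk a v) (hp : walkWeight w p ≤ hammingDist (η a) (η v)) (hj : η a j ≠ η v j) :
    ∃ x y, G.Adj x y ∧ η x j ≠ η y j ∧ hammingDist (η a) (η v) =
      hammingDist (η a) (η x) + hammingDist (η x) (η y) + hammingDist (η y) (η v) := by
  induction p with
  | nil => exact absurd rfl hj
  | @cons a b v h q ih =>
    rw [walkWeight_cons] at hp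
    have h1 := wdist_adj_le G w h
    have h2 : wdist G w b v ≤ walkWeight w q := Nat.sInf_le ⟨q, rfl⟩
    rw [hemb] at h1 h2
    have h3 := hammingDist_triangle (η a) (η b) (η v)
    by_cases hab : η a j = η b j
    · obtain ⟨x, y, hxy, hne, he⟩ := ih (by omega) (hab ▸ hj)
      refine ⟨x, y, hxy, hne, ?_⟩
      have h4 := hammingDist_triangle (η a) (η b) (η x)
      have h5 := hammingDist_triangle (η a) (η x) (η v)
      have h6 := hammingDist_triangle (η x) (η y) (η v)
      omega
    · refine ⟨a, b, h, hab, ?_⟩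
      rw [hammingDist_self]
      omega

lemma theta_swap_left {d : V → V → ℕ} {a b : V} {g : V × V} (h : theta d (b, a) g) :
    theta d (a, b) g := by
  unfold theta at *
  simp only at *
  omega

lemma core (G : SimpleGraph V) (w : V → V → ℕ) (η : V → Fin m → A)
    (hconn : G.Connected)
    (hemb : ∀ x y, wdist G w x y = hammingDist (η x) (η y)) (j : Fin m) {u v a b : V}
    (huv : η u j ≠ η v j) (hab : η a j ≠ η b j) (hav : η a j ≠ η v j) :
    ∃ x y, G.Adj x y ∧ theta (wdist G w) (u, v) (x, y) ∧ theta (wdist G w) (a, b) (x, y) := by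
  obtain ⟨p, hp⟩ := wdist_attained G w hconn a v
  rw [hemb] at hp
  obtain ⟨x, y, hxy, hne, he⟩ := geo_edge G w η hemb j p hp.le hav
  have t1 := hammingDist_triangle (η a) (η x) (η v)
  have t2 := hammingDist_triangle (η x) (η y) (η v)
  have t3 := hammingDist_triangle (η a) (η y) (η v)
  have t4 := hammingDist_triangle (η a) (η x) (η y)
  have e1 : hammingDist (η x) (η v) = hammingDist (η x) (η y) + hammingDist (η y) (η v) := by
    omega
  have e2 : hammingDist (η a) (η y) = hammingDist (η a) (η x) + hammingDist (η x) (η y) := by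
    omega
  have hyv := geo_once _ _ _ e1 j hne
  have hax : η x j = η a j := by
    refine geo_once (η y) (η x) (η a) ?_ j hne.symm
    rw [hammingDist_comm (η y) (η a), hammingDist_comm (η y) (η x), hammingDist_comm (η x) (η a)]
    omega
  refine ⟨x, y, hxy, ?_, ?_⟩
  · intro h
    simp only [hemb] at h
    rw [hammingDist_comm (η v) (η x), hammingDist_comm (η v) (η y)] at h
    refine hne (geo_once (η u) (η y) (η x) ?_ j (by rwa [hyv])).symm
    rw [hammingDist_comm (η y) (η x)]
    omega
  · intro h
    simp only [hemb] at h
    refine hne (geo_once (η b) (η x) (η y) ?_ j (by rw [hax]; exact hab.symm))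
    omega

lemma theta_hat (G : SimpleGraph V) (w : V → V → ℕ) (η : V → Fin m → A)
    (hconn : G.Connected)
    (hemb : ∀ x y, wdist G w x y = hammingDist (η x) (η y)) (j : Fin m)
    (e f : {p : V × V // G.Adj p.1 p.2})
    (he : η e.1.1 j ≠ η e.1.2 j) (hf : η f.1.1 j ≠ η f.1.2 j) :
    Relation.EqvGen
      (fun e f : {p : V × V // G.Adj p.1 p.2} => theta (wdist G w) e.1 f.1) e f := by
  obtain ⟨⟨u, v⟩, huv⟩ := e
  obtain ⟨⟨a, b⟩, hab⟩ := f
  simp only at he hf huv hab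
  have key : ∃ x y, G.Adj x y ∧ theta (wdist G w) (u, v) (x, y) ∧
      theta (wdist G w) (a, b) (x, y) := by
    by_cases h : η a j = η v j
    · obtain ⟨x, y, hxy, h1, h2⟩ := core G w η hconn hemb j he hf.symm (by rw [← h]; exact hf.symm)
      exact ⟨x, y, hxy, h1, theta_swap_left h2⟩
    · exact core G w η hconn hemb j he hf h
  obtain ⟨x, y, hxy, h1, h2⟩ := key
  exact .trans _ ⟨(x, y), hxy⟩ _ (.rel _ _ h1) (.symm _ _ (.rel _ _ h2))

end Helpers

/-- there is a bijection between the θ̂-classes of edges and the γ̂-classes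
of coordinates, sending the class of an edge `uv` to the class of any coordinate
`j ∈ D_η(u,v)`. -/
theorem edge_coord_class_bijection {V A : Type*} [Fintype V] [DecidableEq A] {m : ℕ}
    (G : SimpleGraph V) (w : V → V → ℕ) (η : V → Fin m → A)
    (hconn : G.Connected)
    (hsymm : ∀ u v, w u v = w v u)
    (hpos : ∀ u v, G.Adj u v → 0 < w u v)
    (hemb : ∀ x y, wdist G w x y = hammingDist (η x) (η y))
    (hfull : ∀ j : Fin m, ∃ u v, G.Adj u v ∧ η u j ≠ η v j) :
    ∃ F : Quotient (Relation.EqvGen.setoid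
            (fun e f : {p : V × V // G.Adj p.1 p.2} => theta (wdist G w) e.1 f.1)) ≃
          Quotient (Relation.EqvGen.setoid (gammaRel G η)),
      ∀ (u v : V) (h : G.Adj u v) (j : Fin m), η u j ≠ η v j →
        F (Quotient.mk _ ⟨(u, v), h⟩) = Quotient.mk _ j := by
  classical
  have hc : ∀ e : {p : V × V // G.Adj p.1 p.2}, ∃ j, η e.1.1 j ≠ η e.1.2 j :=
    fun e => adj_coord G w η hconn hpos hemb e.2
  choose c hcc using hc
  have hcg : ∀ (e : {p : V × V // G.Adj p.1 p.2}) (j : Fin m), η e.1.1 j ≠ η e.1.2 j →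
      gammaRel G η (c e) j := fun e j hj => ⟨_, _, e.2, hcc e, hj⟩
  have hwd : ∀ e f : {p : V × V // G.Adj p.1 p.2}, theta (wdist G w) e.1 f.1 →
      Relation.EqvGen (gammaRel G η) (c e) (c f) := by
    intro e f h
    obtain ⟨j, h1, h2⟩ := theta_common η _ hemb _ _ h
    exact .trans _ j _ (.rel _ _ (hcg e j h1)) (.symm _ _ (.rel _ _ (hcg f j h2)))
  have hwd' : ∀ e f : {p : V × V // G.Adj p.1 p.2},
      Relation.EqvGen (fun e f : {p : V × V // G.Adj p.1 p.2} => theta (wdist G w) e.1 f.1) e f →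
      Relation.EqvGen (gammaRel G η) (c e) (c f) := by
    intro e f h
    induction h with
    | rel e f h => exact hwd e f h
    | refl e => exact .refl _
    | symm e f _ ih => exact .symm _ _ ih
    | trans e f g _ _ ih1 ih2 => exact .trans _ _ _ ih1 ih2
  choose a b hab hne using hfull
  -- the inverse map: a coordinate goes to the class of an edge changing it
  have hinv : ∀ j j', Relation.EqvGen (gammaRel G η) j j' →
      Relation.EqvGen (fun e f : {p : V × V // G.Adj p.1 p.2} => theta (wdist G w) e.1 f.1)
        ⟨(a j, b j), hab j⟩ ⟨(a j', b j'), hab j'⟩ := by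
    intro j j' h
    induction h with
    | rel j j' h =>
      obtain ⟨u, v, huv, h1, h2⟩ := h
      exact .trans _ ⟨(u, v), huv⟩ _ (theta_hat G w η hconn hemb j _ _ (hne j) h1)
        (theta_hat G w η hconn hemb j' _ _ h2 (hne j'))
    | refl e => exact .refl _
    | symm e f _ ih => exact .symm _ _ ih
    | trans e f g _ _ ih1 ih2 => exact .trans _ _ _ ih1 ih2
  refine ⟨⟨Quotient.map c hwd', Quotient.map (fun j => ⟨(a j, b j), hab j⟩) hinv, ?_, ?_⟩, ?_⟩
  · rintro ⟨e⟩
    exact Quotient.sound (theta_hat G w η hconn hemb (c e) _ _ (hne _) (hcc e))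
  · rintro ⟨j⟩
    exact Quotient.sound (.rel _ _ (hcg _ j (hne j)))
  · intro u v h j hj
    exact Quotient.sound (.rel _ _ (hcg ⟨(u, v), h⟩ j hj))
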